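/- Let G be a connected decomposable claw-free graph with maximum degree 3 such that χ'_irr(G) > 3 and every decomposable claw-free graph with maximum degree at most 3 and fewer edges than G has locally irregular chromatic index at most 3. Then G contains no 3-cycle incident with two vertices of degree 2. -/

import Mathlib

/-- A graph is *locally irregular* if no two adjacent vertices have the same degree. -/
def LocallyIrregular {V : Type*} (G : SimpleGraph V) : Prop :=
  ∀ ⦃u v : V⦄, G.Adj u v → (G.neighborSet u).ncard ≠ (G.neighborSet v).ncard

/-- `HasLIEC G k` : `G` admits a locally irregular edge-coloring using at most `k` colors,
i.e. an assignment of one of `k` colors to every edge such that the edges of each fixed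
color induce a locally irregular graph. -/
def HasLIEC {V : Type*} (G : SimpleGraph V) (k : ℕ) : Prop :=
  ∃ c : Sym2 V → Fin k, ∀ i : Fin k,
    LocallyIrregular (SimpleGraph.fromEdgeSet {e | e ∈ G.edgeSet ∧ c e = i})

/-- A graph is *decomposable* if it admits a locally irregular edge-coloring. -/
def Decomposable {V : Type*} (G : SimpleGraph V) : Prop :=
  ∃ k : ℕ, HasLIEC G k

/-- A graph is *claw-free* if it contains no induced subgraph isomorphic to `K_{1,3}`. -/
def ClawFree {V : Type*} (G : SimpleGraph V) : Prop :=
  ¬ ∃ v a b c : V, a ≠ b ∧ a ≠ c ∧ b ≠ c ∧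
      G.Adj v a ∧ G.Adj v b ∧ G.Adj v c ∧ ¬ G.Adj a b ∧ ¬ G.Adj a c ∧ ¬ G.Adj b c

/-- `G` has maximum degree at most `d`. -/
def MaxDegreeLE {V : Type*} (G : SimpleGraph V) (d : ℕ) : Prop :=
  ∀ v : V, (G.neighborSet v).ncard ≤ d

theorem hasLIEC_iff' {V : Type*} (G : SimpleGraph V) (k : ℕ) : HasLIEC G k ↔
    ∃ c : Sym2 V → Fin k, ∀ u v, G.Adj u v →
      {w | G.Adj u w ∧ c s(u,w) = c s(u,v)}.ncard ≠ {w | G.Adj v w ∧ c s(v,w) = c s(u,v)}.ncard := by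
  have key : ∀ (c : Sym2 V → Fin k) (i : Fin k) (u : V),
      (SimpleGraph.fromEdgeSet {e | e ∈ G.edgeSet ∧ c e = i}).neighborSet u
        = {w | G.Adj u w ∧ c s(u,w) = i} := by
    intro c i u
    ext w
    simp only [SimpleGraph.mem_neighborSet, SimpleGraph.fromEdgeSet_adj, Set.mem_ofPred_eq,
      SimpleGraph.mem_edgeSet]
    constructor
    · exact fun h => h.1
    · exact fun h => ⟨h, h.1.ne⟩
  unfold HasLIEC LocallyIrregular
  constructor
  · rintro ⟨c, hc⟩
    refine ⟨c, fun u v h => ?_⟩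
    have := @hc (c s(u,v)) u v (by simp [h, h.ne])
    rwa [key, key] at this
  · rintro ⟨c, hc⟩
    refine ⟨c, fun i u v h => ?_⟩
    rw [key, key]
    simp only [SimpleGraph.fromEdgeSet_adj, Set.mem_ofPred_eq, SimpleGraph.mem_edgeSet] at h
    obtain ⟨⟨h1, rfl⟩, _⟩ := h
    exact hc u v h1

theorem ncard_equiv_pre {V W : Type*} (e : V ≃ W) (s : Set W) :
    {v | e v ∈ s}.ncard = s.ncard := by
  have : e '' {v | e v ∈ s} = s := by
    ext x; constructor
    · rintro ⟨y, hy, rfl⟩; exact hy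
    · intro hx; exact ⟨e.symm x, by simpa using hx, by simp⟩
  conv_rhs => rw [← this]
  exact (Set.ncard_image_of_injective _ e.injective).symm

theorem hasLIEC_comap {V W : Type*} (e : V ≃ W) (G : SimpleGraph W) (k : ℕ)
    (h : HasLIEC G k) : HasLIEC (G.comap e) k := by
  rw [hasLIEC_iff'] at h ⊢
  obtain ⟨c, hc⟩ := h
  refine ⟨fun x => c (x.map e), fun u v huv => ?_⟩
  have := hc (e u) (e v) huv
  rw [← ncard_equiv_pre e, ← ncard_equiv_pre e {w | G.Adj (e v) w ∧ _}] at this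
  simpa using this

theorem maxDeg_comap {V W : Type*} (e : V ≃ W) (G : SimpleGraph W) (k : ℕ)
    (h : MaxDegreeLE G k) : MaxDegreeLE (G.comap e) k := by
  intro v
  have := h (e v)
  rw [← ncard_equiv_pre e] at this
  exact this

theorem clawFree_comap {V W : Type*} (e : V ≃ W) (G : SimpleGraph W)
    (h : ClawFree G) : ClawFree (G.comap e) := by
  rintro ⟨v, a, b, c, h1, h2, h3, h4⟩
  exact h ⟨e v, e a, e b, e c, by simpa using h1, by simpa using h2, by simpa using h3, h4⟩

theorem edges_comap {V W : Type*} (e : V ≃ W) (G : SimpleGraph W) :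
    (G.comap e).edgeSet.ncard = G.edgeSet.ncard := by
  have h : Sym2.map e '' (G.comap e).edgeSet = G.edgeSet := by
    ext x
    induction x with
    | _ x y =>
      constructor
      · rintro ⟨z, hz, h⟩
        rw [← h]
        induction z with
        | _ z w => simpa using hz
      · intro h
        exact ⟨s(e.symm x, e.symm y), by simpa using h, by simp⟩
  rw [← h]
  exact (Set.ncard_image_of_injective _ (Sym2.map.injective e.injective)).symm

/-- G minus all edges at b -/
def isolate {V : Type*} (G : SimpleGraph V) (b : V) : SimpleGraph V where
  Adj u v := G.Adj u v ∧ u ≠ b ∧ v ≠ b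
  symm := ⟨fun _ _ h => ⟨h.1.symm, h.2.2, h.2.1⟩⟩
  loopless := ⟨fun _ h => h.1.ne rfl⟩

theorem core_step {V : Type*} [Fintype V] (G : SimpleGraph V)
    (hclaw : ClawFree G)
    (hdeg : MaxDegreeLE G 3) (hG : ¬ HasLIEC G 3)
    (hmin : ∀ (W : Type) [Fintype W] (H : SimpleGraph W),
      Decomposable H → ClawFree H → MaxDegreeLE H 3 →
      H.edgeSet.ncard < G.edgeSet.ncard → HasLIEC H 3)
    (a b c : V) (hab : G.Adj a b) (hbc : G.Adj b c) (hac : G.Adj a c)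
    (na : ∀ v, G.Adj a v ↔ v = b ∨ v = c)
    (nb : ∀ v, G.Adj b v ↔ v = a ∨ v = c)
    (nc : ∀ v w, G.Adj c v → G.Adj c w → v ≠ a → v ≠ b → w ≠ a → w ≠ b → v = w)
    (k : ℕ) (c0 : Sym2 V → Fin k)
    (hc0 : ∀ u v, G.Adj u v →
      {w | G.Adj u w ∧ c0 s(u,w) = c0 s(u,v)}.ncard ≠ {w | G.Adj v w ∧ c0 s(v,w) = c0 s(u,v)}.ncard)
    (h1 : c0 s(b,c) = c0 s(a,b)) (h2 : c0 s(a,c) ≠ c0 s(a,b)) : False := by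
  have hab' := hab.ne
  have hbc' := hbc.ne
  have hac' := hac.ne
  have hcv : ∀ v, G.Adj c v → v ≠ b → c0 s(c,v) ≠ c0 s(a,b) := by
    intro v hv hvb hcol
    have hva : v ≠ a := by
      rintro rfl; rw [Sym2.eq_swap] at hcol; exact h2 hcol
    apply hc0 b c hbc
    have e1 : {w | G.Adj b w ∧ c0 s(b,w) = c0 s(b,c)} = {a, c} := by
      ext w
      simp only [Set.mem_ofPred_eq, Set.mem_insert_iff, Set.mem_singleton_iff, nb]
      constructor
      · exact fun h => h.1
      · rintro (rfl | rfl)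
        · exact ⟨Or.inl rfl, by rw [Sym2.eq_swap, h1]⟩
        · exact ⟨Or.inr rfl, rfl⟩
    have e2 : {w | G.Adj c w ∧ c0 s(c,w) = c0 s(b,c)} = {b, v} := by
      ext w
      simp only [Set.mem_ofPred_eq, Set.mem_insert_iff, Set.mem_singleton_iff]
      constructor
      · rintro ⟨hw, hwc⟩
        by_cases hwb : w = b
        · exact Or.inl hwb
        · right
          refine nc w v hw hv ?_ hwb hva hvb
          rintro rfl
          rw [Sym2.eq_swap] at hwc
          exact h2 (hwc.trans h1)
      · rintro (rfl | rfl)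
        · exact ⟨hbc.symm, by rw [Sym2.eq_swap]⟩
        · exact ⟨hv, by rw [hcol, h1]⟩
    rw [e1, e2, Set.ncard_pair hac', Set.ncard_pair hvb.symm]
  set H := isolate G b with hH
  have HA : ∀ u v, H.Adj u v ↔ G.Adj u v ∧ u ≠ b ∧ v ≠ b := fun _ _ => Iff.rfl
  have hdecH : HasLIEC H k := by
    rw [hasLIEC_iff']
    refine ⟨c0, ?_⟩
    have key : ∀ u v, H.Adj u v → {w | H.Adj u w ∧ c0 s(u,w) = c0 s(u,v)}
        = {w | G.Adj u w ∧ c0 s(u,w) = c0 s(u,v)} := by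
      intro u v huv
      obtain ⟨g, hu, hv⟩ := huv
      ext w
      simp only [Set.mem_ofPred_eq, HA]
      constructor
      · exact fun h => ⟨h.1.1, h.2⟩
      · rintro ⟨h, hcol⟩
        refine ⟨⟨h, hu, ?_⟩, hcol⟩
        rintro rfl
        rcases (nb u).1 h.symm with rfl | rfl
        · rcases (na v).1 g with rfl | rfl
          · exact hv rfl
          · exact h2 hcol.symm
        · apply hcv v g hv
          rw [← hcol, Sym2.eq_swap, h1]
    intro u v huv
    rw [key u v huv]
    have := key v u huv.symm
    rw [Sym2.eq_swap] at this
    rw [this]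
    exact hc0 u v huv.1
  have hclawH : ClawFree H := by
    have back : ∀ x y, x ≠ b → y ≠ b → ¬ H.Adj x y → ¬ G.Adj x y := fun x y h h' hn g => hn ⟨g, h, h'⟩
    rintro ⟨v, x, y, z, hxy, hxz, hyz, hx, hy, hz, n1, n2, n3⟩
    exact hclaw ⟨v, x, y, z, hxy, hxz, hyz, hx.1, hy.1, hz.1, back _ _ hx.2.2 hy.2.2 n1,
      back _ _ hx.2.2 hz.2.2 n2, back _ _ hy.2.2 hz.2.2 n3⟩
  have hdegH : MaxDegreeLE H 3 := by
    intro v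
    refine le_trans (Set.ncard_le_ncard ?_ (Set.toFinite _)) (hdeg v)
    intro w hw
    exact hw.1
  have hcardH : H.edgeSet.ncard < G.edgeSet.ncard := by
    apply Set.ncard_lt_ncard _ (Set.toFinite _)
    rw [SimpleGraph.edgeSet_ssubset_edgeSet]
    refine lt_of_le_of_ne (fun u v h => h.1) ?_
    intro h
    have : H.Adj a b := by rw [h]; exact hab
    exact this.2.2 rfl
  have hL : HasLIEC H 3 := by
    let e := Fintype.equivFin V
    have := hmin (Fin (Fintype.card V)) (H.comap e.symm) ⟨k, hasLIEC_comap _ _ _ hdecH⟩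
      (clawFree_comap _ _ hclawH) (maxDeg_comap _ _ _ hdegH) (by rw [edges_comap]; exact hcardH)
    have := hasLIEC_comap e _ _ this
    have e2 : (H.comap e.symm).comap e = H := by
      ext u v; simp
    rwa [e2] at this
  rw [hasLIEC_iff'] at hL
  obtain ⟨c1, hc1⟩ := hL
  have hcc : ∀ v, H.Adj c v → c1 s(c,v) = c1 s(a,c) := by
    rintro v ⟨hv, -, hvb⟩
    by_contra hne
    have hva : v ≠ a := by
      rintro rfl; exact hne (by rw [Sym2.eq_swap])
    apply hc1 a c ⟨hac, hab', hbc'.symm⟩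
    have e1 : {w | H.Adj a w ∧ c1 s(a,w) = c1 s(a,c)} = {c} := by
      ext w
      simp only [Set.mem_ofPred_eq, Set.mem_singleton_iff, HA, na]
      constructor
      · rintro ⟨⟨h | h, _, h'⟩, _⟩
        · exact absurd h h'
        · exact h
      · rintro rfl
        exact ⟨⟨Or.inr rfl, hab', hbc'.symm⟩, rfl⟩
    have e2 : {w | H.Adj c w ∧ c1 s(c,w) = c1 s(a,c)} = {a} := by
      ext w
      simp only [Set.mem_ofPred_eq, Set.mem_singleton_iff, HA]
      constructor
      · rintro ⟨⟨h, _, h'⟩, h3⟩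
        by_contra hwa
        have := nc w v h hv hwa h' hva hvb
        subst this
        exact hne h3
      · rintro rfl
        exact ⟨⟨hac.symm, hbc'.symm, hab'⟩, by rw [Sym2.eq_swap]⟩
    rw [e1, e2, Set.ncard_singleton, Set.ncard_singleton]
  obtain ⟨β, hβ⟩ : ∃ β : Fin 3, β ≠ c1 s(a,c) := exists_ne _
  apply hG
  rw [hasLIEC_iff']
  classical
  let c2 : Sym2 V → Fin 3 := fun e => if b ∈ e then β else c1 e
  have c2b : ∀ v, c2 s(b,v) = β := fun v => by simp [c2]
  have c2b' : ∀ v, c2 s(v,b) = β := fun v => by simp [c2]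
  have c2n : ∀ u v, u ≠ b → v ≠ b → c2 s(u,v) = c1 s(u,v) := fun u v h h' => by
    simp [c2, h.symm, h'.symm]
  have key : ∀ u v, H.Adj u v → {w | G.Adj u w ∧ c2 s(u,w) = c2 s(u,v)}
      = {w | H.Adj u w ∧ c1 s(u,w) = c1 s(u,v)} := by
    rintro u v ⟨g, hu, hv⟩
    ext w
    simp only [Set.mem_ofPred_eq, HA]
    rw [c2n u v hu hv]
    constructor
    · rintro ⟨h, hcol⟩
      have hwb : w ≠ b := by
        rintro rfl
        rw [c2b'] at hcol
        rcases (nb u).1 h.symm with rfl | rfl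
        · rcases (na v).1 g with rfl | rfl
          · exact hv rfl
          · exact hβ hcol
        · exact hβ (hcol.trans (hcc v ⟨g, hu, hv⟩))
      rw [c2n u w hu hwb] at hcol
      exact ⟨⟨h, hu, hwb⟩, hcol⟩
    · rintro ⟨⟨h, _, hwb⟩, hcol⟩
      exact ⟨h, by rw [c2n u w hu hwb]; exact hcol⟩
  have Nb : {w | G.Adj b w ∧ c2 s(b,w) = β}.ncard = 2 := by
    have : {w | G.Adj b w ∧ c2 s(b,w) = β} = {a, c} := by
      ext w
      simp [c2b, nb]
    rw [this, Set.ncard_pair hac']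
  have Nv : ∀ v, G.Adj b v → {w | G.Adj v w ∧ c2 s(v,w) = β}.ncard = 1 := by
    intro v hv
    have hvb := hv.ne.symm
    have : {w | G.Adj v w ∧ c2 s(v,w) = β} = {b} := by
      ext w
      simp only [Set.mem_ofPred_eq, Set.mem_singleton_iff]
      constructor
      · rintro ⟨h, hcol⟩
        by_contra hwb
        rw [c2n v w hvb hwb] at hcol
        rcases (nb v).1 hv with rfl | rfl
        · rcases (na w).1 h with rfl | rfl
          · exact hwb rfl
          · exact hβ hcol.symm
        · exact hβ (hcol.symm.trans (hcc w ⟨h, hvb, hwb⟩))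
      · rintro rfl
        exact ⟨hv.symm, c2b' _⟩
    rw [this, Set.ncard_singleton]
  refine ⟨c2, fun u v huv => ?_⟩
  by_cases hu : u = b
  · subst hu
    rw [c2b, Nb, Nv v huv]; decide
  by_cases hv : v = b
  · subst hv
    rw [c2b', Nb, Nv u huv.symm]; decide
  have hh : H.Adj u v := ⟨huv, hu, hv⟩
  rw [key u v hh]
  have := key v u hh.symm
  rw [Sym2.eq_swap] at this
  rw [this]
  have := hc1 u v hh
  exact this

theorem nbrs_two {V : Type*} [Fintype V] (G : SimpleGraph V) (a b c : V)
    (hab : G.Adj a b) (hac : G.Adj a c) (hbc : b ≠ c) (h : (G.neighborSet a).ncard = 2) :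
    ∀ v, G.Adj a v ↔ v = b ∨ v = c := by
  have hs : ({b, c} : Set V) ⊆ G.neighborSet a := by
    rintro x (rfl | rfl)
    · exact hab
    · exact hac
  have := Set.eq_of_subset_of_ncard_le hs (by rw [h, Set.ncard_pair hbc]) (Set.toFinite _)
  intro v
  have h2 : v ∈ G.neighborSet a ↔ v ∈ ({b, c} : Set V) := by rw [this]
  simpa using h2

/-- In a minimal counterexample to the 3-color theorem for claw-free subcubic graphs, there is no 3-cycle incident with two vertices of degree 2. -/
theorem minimal_cex_no_triangle_two_deg2 {V : Type*} [Fintype V] (G : SimpleGraph V)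
    (hconn : G.Connected) (hdec : Decomposable G) (hclaw : ClawFree G)
    (hdeg : MaxDegreeLE G 3) (hG : ¬ HasLIEC G 3)
    (hmin : ∀ (W : Type) [Fintype W] (H : SimpleGraph W),
      Decomposable H → ClawFree H → MaxDegreeLE H 3 →
      H.edgeSet.ncard < G.edgeSet.ncard → HasLIEC H 3) :
    ¬ ∃ a b c : V, G.Adj a b ∧ G.Adj b c ∧ G.Adj a c ∧
      (G.neighborSet a).ncard = 2 ∧ (G.neighborSet b).ncard = 2 := by
  rintro ⟨a, b, c, hab, hbc, hac, da, db⟩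
  have na := nbrs_two G a b c hab hac hbc.ne da
  have nb := nbrs_two G b a c hab.symm hbc hac.ne db
  have nc : ∀ v w, G.Adj c v → G.Adj c w → v ≠ a → v ≠ b → w ≠ a → w ≠ b → v = w := by
    intro v w hv hw hva hvb hwa hwb
    by_contra hvw
    classical
    have hs : ((({a, b, v, w} : Finset V)) : Set V) ⊆ G.neighborSet c := by
      intro x hx
      simp only [Finset.coe_insert, Finset.coe_singleton, Set.mem_insert_iff,
        Set.mem_singleton_iff] at hx
      rcases hx with rfl | rfl | rfl | rfl
      · exact hac.symm
      · exact hbc.symm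
      · exact hv
      · exact hw
    have h4 : (({a, b, v, w} : Finset V)).card = 4 := by
      have := hab.ne
      rw [Finset.card_insert_of_notMem, Finset.card_insert_of_notMem,
        Finset.card_insert_of_notMem, Finset.card_singleton]
      · simpa using hvw
      · simp [hvb.symm, hwb.symm]
      · simp [this, hva.symm, hwa.symm]
    have := Set.ncard_le_ncard hs (Set.toFinite _)
    rw [Set.ncard_coe_finset, h4] at this
    have := hdeg c
    omega
  obtain ⟨k, hk⟩ := hdec
  rw [hasLIEC_iff'] at hk
  obtain ⟨c0, hc0⟩ := hk
  have hba : s(b,a) = s(a,b) := Sym2.eq_swap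
  by_cases h1 : c0 s(b,c) = c0 s(a,b)
  · by_cases h2 : c0 s(a,c) = c0 s(a,b)
    · apply hc0 a b hab
      have e1 : {w | G.Adj a w ∧ c0 s(a,w) = c0 s(a,b)} = {b, c} := by
        ext w
        simp only [Set.mem_ofPred_eq, na, Set.mem_insert_iff, Set.mem_singleton_iff]
        constructor
        · exact fun h => h.1
        · rintro (rfl | rfl) <;> simp [h2]
      have e2 : {w | G.Adj b w ∧ c0 s(b,w) = c0 s(a,b)} = {a, c} := by
        ext w
        simp only [Set.mem_ofPred_eq, nb, Set.mem_insert_iff, Set.mem_singleton_iff]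
        constructor
        · exact fun h => h.1
        · rintro (rfl | rfl) <;> simp [h1, hba]
      rw [e1, e2, Set.ncard_pair hbc.ne, Set.ncard_pair hac.ne]
    · exact core_step G hclaw hdeg hG hmin a b c hab hbc hac na nb nc k c0 hc0 h1 h2
  · by_cases h2 : c0 s(a,c) = c0 s(a,b)
    · exact core_step G hclaw hdeg hG hmin b a c hab.symm hac hbc nb na
        (fun v w hv hw q1 q2 q3 q4 => nc v w hv hw q2 q1 q4 q3) k c0 hc0
        (by rw [hba]; exact h2) (by rw [hba]; exact h1)
    · apply hc0 a b hab
      have e1 : {w | G.Adj a w ∧ c0 s(a,w) = c0 s(a,b)} = {b} := by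
        ext w
        simp only [Set.mem_ofPred_eq, na, Set.mem_singleton_iff]
        constructor
        · rintro ⟨rfl | rfl, h⟩
          · rfl
          · exact absurd h h2
        · rintro rfl; simp
      have e2 : {w | G.Adj b w ∧ c0 s(b,w) = c0 s(a,b)} = {a} := by
        ext w
        simp only [Set.mem_ofPred_eq, nb, Set.mem_singleton_iff]
        constructor
        · rintro ⟨rfl | rfl, h⟩
          · rfl
          · exact absurd h h1
        · rintro rfl; simp [hba]
      rw [e1, e2, Set.ncard_singleton, Set.ncard_singleton]
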